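/- Let x_* be a minimizer of F. Consider sequences {x_k}_{k≥−1} ⊂ ℝⁿ, {y_k}_{k≥1} ⊂ ℝⁿ, {t_k}_{k≥1} with t_k ≥ 1, {σ_k}_{k≥1} with σ_k > 0, and symmetric positive definite matrices {H_k}_{k≥1} satisfying: x_{−1} = x_0, y_1 = x_0, t_1 = 1, σ_1 = 1, H_1 = I; for every k ≥ 1, x_k = p_{H_k}(y_k) with F(x_k) ≤ Q_{H_k}(x_k, y_k), y_{k+1} = x_k + ((t_k − 1)/t_{k+1})(x_k − x_{k−1}), σ_{k+1} H_{k+1} ⪯ σ_k H_k, and σ_k t_k² ≥ σ_{k+1} t_{k+1}(t_{k+1} − 1). Then for every k ≥ 1, F(x_k) − F(x_*) ≤ ‖x_0 − x_*‖² / (2 σ_k t_k²). -/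

import Mathlib

open scoped RealInnerProductSpace
open Finset

/-- Matrix-vector product, viewed as an operation on Euclidean space. -/
noncomputable def mulVecE {n : ℕ} (H : Matrix (Fin n) (Fin n) ℝ)
    (w : EuclideanSpace ℝ (Fin n)) : EuclideanSpace ℝ (Fin n) :=
  (WithLp.equiv 2 (Fin n → ℝ)).symm (H.mulVec ((WithLp.equiv 2 (Fin n → ℝ)) w))

/-- The composite quadratic approximation
`Q_H(u,v) = f(v) + ⟨∇f(v), u−v⟩ + (1/2)⟨H(u−v), u−v⟩ + g(u)`. -/
noncomputable def Qa {n : ℕ} (f g : EuclideanSpace ℝ (Fin n) → ℝ)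
    (H : Matrix (Fin n) (Fin n) ℝ) (u v : EuclideanSpace ℝ (Fin n)) : ℝ :=
  f v + ⟪ gradient f v, u - v ⟫ + (1 / 2) * ⟪ mulVecE H (u - v), u - v ⟫ + g u

theorem mulVecE_eq_toEuclideanLin {n : ℕ} (H : Matrix (Fin n) (Fin n) ℝ)
    (w : EuclideanSpace ℝ (Fin n)) : mulVecE H w = H.toEuclideanLin w := by
  rfl

theorem Matrix.PosSemidef.inner_toEuclideanLin_nonneg {n : ℕ} {A : Matrix (Fin n) (Fin n) ℝ}
    (hA : A.PosSemidef) (w : EuclideanSpace ℝ (Fin n)) : 0 ≤ ⟪A.toEuclideanLin w, w⟫ :=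
  (Matrix.isPositive_toEuclideanLin_iff.2 hA).re_inner_nonneg_left w

theorem LinearMap.IsSymmetric.inner_map_add_smul {E : Type*} [NormedAddCommGroup E]
    [InnerProductSpace ℝ E] {T : E →ₗ[ℝ] E} (hT : T.IsSymmetric) (a b : E) (s : ℝ) :
    ⟪T (a + s • b), a + s • b⟫ = ⟪T a, a⟫ + 2 * s * ⟪T a, b⟫ + s ^ 2 * ⟪T b, b⟫ := by
  have h : ⟪T b, a⟫ = ⟪T a, b⟫ := by rw [hT b a, real_inner_comm]
  simp only [map_add, map_smul, inner_add_left, inner_add_right, real_inner_smul_left,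
    real_inner_smul_right, h]
  ring

theorem inner_map_smul_self {E : Type*} [NormedAddCommGroup E]
    [InnerProductSpace ℝ E] (T : E →ₗ[ℝ] E) (s : ℝ) (a : E) :
    ⟪T (s • a), s • a⟫ = s ^ 2 * ⟪T a, a⟫ := by
  simp only [map_smul, real_inner_smul_left, real_inner_smul_right]
  ring

/-- The gradient inequality for a differentiable convex function. -/
theorem ConvexOn.add_inner_gradient_le {E : Type*} [NormedAddCommGroup E]
    [InnerProductSpace ℝ E] [CompleteSpace E] {f : E → ℝ} (hf : ConvexOn ℝ Set.univ f) {v : E}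
    (hfd : DifferentiableAt ℝ f v) (z : E) : f v + ⟪gradient f v, z - v⟫ ≤ f z := by
  have hline : ConvexOn ℝ Set.univ (f ∘ AffineMap.lineMap (k := ℝ) v z) := by
    simpa using hf.comp_affineMap (AffineMap.lineMap (k := ℝ) v z)
  have hderiv : HasDerivAt (f ∘ AffineMap.lineMap (k := ℝ) v z) ⟪gradient f v, z - v⟫ 0 := by
    rw [inner_gradient_left]
    refine HasFDerivAt.comp_hasDerivAt (0 : ℝ) ?_ AffineMap.hasDerivAt_lineMap
    simpa using hfd.hasFDerivAt
  have hslope := hline.le_slope_of_hasDerivAt (Set.mem_univ 0) (Set.mem_univ 1) zero_lt_one hderiv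
  simp only [slope_def_field, Function.comp_apply, AffineMap.lineMap_apply_zero,
    AffineMap.lineMap_apply_one, sub_zero, div_one] at hslope
  linarith

theorem nonneg_of_forall_mul_add_sq_mul_nonneg {a b : ℝ}
    (h : ∀ θ : ℝ, 0 < θ → θ ≤ 1 → 0 ≤ θ * a + θ ^ 2 * b) : 0 ≤ a := by
  by_contra! ha
  have hb : 0 < |b| + 1 := by positivity
  set θ := min 1 (-a / (2 * (|b| + 1))) with hθ
  have hθ0 : 0 < θ := lt_min one_pos (div_pos (by linarith) (by linarith))
  have hθa : θ * (2 * (|b| + 1)) ≤ -a := (le_div_iff₀ (by linarith)).1 (min_le_right _ _)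
  have hθb : θ * b ≤ θ * (|b| + 1) :=
    mul_le_mul_of_nonneg_left (by linarith [le_abs_self b]) hθ0.le
  have hneg : θ * (a + θ * b) < 0 := mul_neg_of_pos_of_neg hθ0 (by linarith)
  nlinarith [h θ hθ0 (min_le_left _ _)]

/-- The three-point inequality for a proximal quasi-Newton step satisfying the sufficient decrease
condition. -/
theorem add_half_inner_le_of_isMin_Qa {n : ℕ} {f g : EuclideanSpace ℝ (Fin n) → ℝ}
    (hf : ConvexOn ℝ Set.univ f) (hfd : Differentiable ℝ f) (hg : ConvexOn ℝ Set.univ g)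
    {H : Matrix (Fin n) (Fin n) ℝ} (hH : H.IsHermitian) {p v : EuclideanSpace ℝ (Fin n)}
    (hmin : ∀ u, Qa f g H p v ≤ Qa f g H u v) (hdec : f p + g p ≤ Qa f g H p v)
    (z : EuclideanSpace ℝ (Fin n)) :
    f p + g p + 1 / 2 * ⟪H.toEuclideanLin (z - p), z - p⟫ ≤
      f z + g z + 1 / 2 * ⟪H.toEuclideanLin (z - v), z - v⟫ := by
  have hT : H.toEuclideanLin.IsSymmetric := Matrix.isSymmetric_toEuclideanLin_iff.2 hH
  simp only [Qa, mulVecE_eq_toEuclideanLin] at hmin hdec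
  have hfirst : 0 ≤ ⟪gradient f v, z - p⟫ + ⟪H.toEuclideanLin (p - v), z - p⟫ + (g z - g p) := by
    refine nonneg_of_forall_mul_add_sq_mul_nonneg
      (b := 1 / 2 * ⟪H.toEuclideanLin (z - p), z - p⟫) fun θ hθ0 hθ1 => ?_
    have hgθ : g (p + θ • (z - p)) ≤ (1 - θ) * g p + θ * g z := by
      have h := hg.2 (Set.mem_univ p) (Set.mem_univ z) (sub_nonneg.2 hθ1) hθ0.le (by ring)
      rwa [show (1 - θ) • p + θ • z = p + θ • (z - p) by module] at h
    have h := hmin (p + θ • (z - p))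
    rw [show p + θ • (z - p) - v = (p - v) + θ • (z - p) by module, hT.inner_map_add_smul,
      inner_add_right, real_inner_smul_right] at h
    linarith
  have hgrad := hf.add_inner_gradient_le (hfd v) z
  have hsplit : z - v = (p - v) + (1 : ℝ) • (z - p) := by module
  have hquad := hT.inner_map_add_smul (p - v) (z - p) 1
  rw [← hsplit] at hquad
  have hlin : ⟪gradient f v, z - v⟫ = ⟪gradient f v, p - v⟫ + ⟪gradient f v, z - p⟫ := by
    rw [← inner_add_right]; congr 1; module
  linarith

/-- One accelerated step, from the extrapolated point `v` with `τ • v - (τ - 1) • x - xs = u`. -/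
theorem accelerated_step {n : ℕ} {f g : EuclideanSpace ℝ (Fin n) → ℝ}
    (hf : ConvexOn ℝ Set.univ f) (hfd : Differentiable ℝ f) (hg : ConvexOn ℝ Set.univ g)
    {H : Matrix (Fin n) (Fin n) ℝ} (hH : H.IsHermitian) {p v : EuclideanSpace ℝ (Fin n)}
    (hmin : ∀ u, Qa f g H p v ≤ Qa f g H u v) (hdec : f p + g p ≤ Qa f g H p v)
    (x xs : EuclideanSpace ℝ (Fin n)) {τ : ℝ} (hτ : 1 ≤ τ) :
    2 * τ ^ 2 * (f p + g p - (f xs + g xs)) +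
        ⟪H.toEuclideanLin (τ • p - (τ - 1) • x - xs), τ • p - (τ - 1) • x - xs⟫ ≤
      2 * (τ * (τ - 1)) * (f x + g x - (f xs + g xs)) +
        ⟪H.toEuclideanLin (τ • v - (τ - 1) • x - xs), τ • v - (τ - 1) • x - xs⟫ := by
  have hτ0 : 0 < τ := one_pos.trans_le hτ
  set z := (1 - τ⁻¹) • x + τ⁻¹ • xs with hz
  have hτz : τ • z = (τ - 1) • x + xs := by
    rw [hz, smul_add, smul_smul, smul_smul, mul_inv_cancel₀ hτ0.ne', one_smul, mul_sub,
      mul_inv_cancel₀ hτ0.ne', mul_one]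
  have hsq (w : EuclideanSpace ℝ (Fin n)) :
      ⟪H.toEuclideanLin (τ • w - (τ - 1) • x - xs), τ • w - (τ - 1) • x - xs⟫ =
        τ ^ 2 * ⟪H.toEuclideanLin (z - w), z - w⟫ := by
    have h : τ • w - (τ - 1) • x - xs = (-τ) • (z - w) := by
      rw [neg_smul, smul_sub, hτz]; abel
    rw [h, inner_map_smul_self, neg_sq]
  have hFz : τ * (f z + g z) ≤ (τ - 1) * (f x + g x) + (f xs + g xs) := by
    have h := (hf.add hg).2 (Set.mem_univ x) (Set.mem_univ xs)
      (sub_nonneg.2 (inv_le_one_of_one_le₀ hτ)) (inv_nonneg.2 hτ0.le) (by ring)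
    calc τ * (f z + g z)
        ≤ τ * ((1 - τ⁻¹) * (f x + g x) + τ⁻¹ * (f xs + g xs)) :=
          mul_le_mul_of_nonneg_left h hτ0.le
      _ = (τ - 1) * (f x + g x) + (f xs + g xs) := by field_simp
  have h3 := add_half_inner_le_of_isMin_Qa hf hfd hg hH hmin hdec z
  rw [hsq, hsq]
  nlinarith [mul_le_mul_of_nonneg_left h3 (sq_nonneg τ), mul_le_mul_of_nonneg_left hFz hτ0.le]

theorem stmt13 {n : ℕ} (f g : EuclideanSpace ℝ (Fin n) → ℝ)
    (hf : ConvexOn ℝ Set.univ f) (hfd : Differentiable ℝ f)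
    (L : ℝ) (hL : 0 < L)
    (hflip : ∀ x y, ‖gradient f x - gradient f y‖ ≤ L * ‖x - y‖)
    (hg : ConvexOn ℝ Set.univ g) (hgc : Continuous g)
    (xs : EuclideanSpace ℝ (Fin n)) (hxs : ∀ z, f xs + g xs ≤ f z + g z)
    (x y : ℕ → EuclideanSpace ℝ (Fin n)) (t σ : ℕ → ℝ)
    (H : ℕ → Matrix (Fin n) (Fin n) ℝ)
    (hHpd : ∀ k, 1 ≤ k → (H k).PosDef)
    (hσpos : ∀ k, 1 ≤ k → 0 < σ k)
    (hy1 : y 1 = x 0) (ht1 : t 1 = 1) (hσ1 : σ 1 = 1)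
    (hH1 : H 1 = (1 : Matrix (Fin n) (Fin n) ℝ))
    (htge : ∀ k, 1 ≤ k → 1 ≤ t k)
    (htineq : ∀ k, 1 ≤ k → σ (k + 1) * t (k + 1) * (t (k + 1) - 1) ≤ σ k * t k ^ 2)
    (hmin : ∀ k, 1 ≤ k → ∀ u, Qa f g (H k) (x k) (y k) ≤ Qa f g (H k) u (y k))
    (hdec : ∀ k, 1 ≤ k → f (x k) + g (x k) ≤ Qa f g (H k) (x k) (y k))
    (hyrec : ∀ k, 1 ≤ k →
      y (k + 1) = x k + ((t k - 1) / t (k + 1)) • (x k - x (k - 1)))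
    (hLoew : ∀ k, 1 ≤ k → (σ k • H k - σ (k + 1) • H (k + 1)).PosSemidef)
    :
    ∀ k : ℕ, 1 ≤ k →
      (f (x k) + g (x k)) - (f xs + g xs) ≤ ‖x 0 - xs‖ ^ 2 / (2 * σ k * t k ^ 2) := by
  have hlyap : ∀ k, 1 ≤ k →
      2 * (σ k * t k ^ 2) * (f (x k) + g (x k) - (f xs + g xs)) +
        σ k * ⟪(H k).toEuclideanLin (t k • x k - (t k - 1) • x (k - 1) - xs),
          t k • x k - (t k - 1) • x (k - 1) - xs⟫ ≤ ‖x 0 - xs‖ ^ 2 := by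
    intro k hk
    induction k, hk using Nat.le_induction with
    | base =>
      have h := accelerated_step hf hfd hg (hHpd 1 le_rfl).1 (hmin 1 le_rfl) (hdec 1 le_rfl)
        (x 0) xs le_rfl
      simpa [ht1, hσ1, hH1, hy1, Matrix.toLpLin_apply] using h
    | succ k hk ih =>
      have hk' : 1 ≤ k + 1 := Nat.le_add_left 1 k
      have ht0 : t (k + 1) ≠ 0 := (one_pos.trans_le (htge _ hk')).ne'
      have h := accelerated_step hf hfd hg (hHpd _ hk').1 (hmin _ hk') (hdec _ hk')
        (x k) xs (htge _ hk')
      have hu : t (k + 1) • y (k + 1) - (t (k + 1) - 1) • x k - xs =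
          t k • x k - (t k - 1) • x (k - 1) - xs := by
        rw [hyrec k hk, smul_add, smul_smul, mul_div_cancel₀ _ ht0]
        module
      rw [hu] at h
      set u := t k • x k - (t k - 1) • x (k - 1) - xs
      have hmono : σ (k + 1) * ⟪(H (k + 1)).toEuclideanLin u, u⟫ ≤
          σ k * ⟪(H k).toEuclideanLin u, u⟫ := by
        have h0 := (hLoew k hk).inner_toEuclideanLin_nonneg u
        simp only [map_sub, map_smul, LinearMap.sub_apply, LinearMap.smul_apply, inner_sub_left,
          real_inner_smul_left] at h0
        linarith
      have hgap := mul_le_mul_of_nonneg_right (htineq k hk) (sub_nonneg.2 (hxs (x k)))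
      have hstep := mul_le_mul_of_nonneg_left h (hσpos _ hk').le
      rw [Nat.add_sub_cancel]
      linarith
  intro k hk
  have hσ0 := hσpos k hk
  have ht0 : 0 < t k := one_pos.trans_le (htge k hk)
  rw [le_div_iff₀ (by positivity)]
  have hquad := mul_nonneg hσ0.le
    ((hHpd k hk).posSemidef.inner_toEuclideanLin_nonneg (t k • x k - (t k - 1) • x (k - 1) - xs))
  linarith [hlyap k hk]
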